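/- arXiv:1906.06588 — 3 statements merged into one kernel-verified Lean document; each statement's English description precedes it below -/
import Mathlib

section
/- Let H be a natural number, let γ be a real number, and let r, S : Fin H → ℝ with r i ≥ 0 for all i and ∑_{i ∈ Fin H} r i ≤ 1. Set M = ∑_{j ∈ Fin H} γ^j · r j · S j. Then ∑_{i ∈ Fin H} ∑_{j ∈ Fin H} γ^{i+j} · r i · r j · S i · S j - ∑_{i ∈ Fin H} γ^{2i} · r i · (S i)^2 ≤ - ∑_{i ∈ Fin H} r i · (γ^i · S i - M)^2, and the right-hand side is nonpositive. -/
/-- Expansion of a weighted sum of squared deviations from an arbitrary point. -/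
theorem sum_mul_sub_sq {ι : Type*} (s : Finset ι) (w x : ι → ℝ) (m : ℝ) :
    ∑ i ∈ s, w i * (x i - m) ^ 2 =
      ∑ i ∈ s, w i * x i ^ 2 - 2 * m * ∑ i ∈ s, w i * x i + m ^ 2 * ∑ i ∈ s, w i := by
  rw [Finset.mul_sum, Finset.mul_sum, ← Finset.sum_sub_distrib, ← Finset.sum_add_distrib]
  exact Finset.sum_congr rfl fun i _ => by ring

theorem stmt_7 {H : ℕ} (γ : ℝ) (r S : Fin H → ℝ)
    (hr : ∀ i, 0 ≤ r i) (hr1 : ∑ i : Fin H, r i ≤ 1) :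
    (∑ i : Fin H, ∑ j : Fin H, γ ^ ((i : ℕ) + (j : ℕ)) * r i * r j * S i * S j -
          ∑ i : Fin H, γ ^ (2 * (i : ℕ)) * r i * (S i) ^ 2 ≤
        -∑ i : Fin H,
            r i * (γ ^ (i : ℕ) * S i - ∑ j : Fin H, γ ^ (j : ℕ) * r j * S j) ^ 2) ∧
    (-∑ i : Fin H,
          r i * (γ ^ (i : ℕ) * S i - ∑ j : Fin H, γ ^ (j : ℕ) * r j * S j) ^ 2 ≤ 0) := by
  refine ⟨?_, neg_nonpos.mpr <| Finset.sum_nonneg fun i _ => mul_nonneg (hr i) (sq_nonneg _)⟩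
  have hdouble : ∑ i : Fin H, ∑ j : Fin H, γ ^ ((i : ℕ) + (j : ℕ)) * r i * r j * S i * S j =
      (∑ j : Fin H, γ ^ (j : ℕ) * r j * S j) ^ 2 := by
    rw [sq, Finset.sum_mul_sum]
    exact Finset.sum_congr rfl fun i _ => Finset.sum_congr rfl fun j _ => by ring
  have hsq : ∑ i : Fin H, γ ^ (2 * (i : ℕ)) * r i * (S i) ^ 2 =
      ∑ i : Fin H, r i * (γ ^ (i : ℕ) * S i) ^ 2 :=
    Finset.sum_congr rfl fun i _ => by ring
  have hmean : ∑ i : Fin H, r i * (γ ^ (i : ℕ) * S i) = ∑ j : Fin H, γ ^ (j : ℕ) * r j * S j :=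
    Finset.sum_congr rfl fun i _ => by ring
  rw [hdouble, hsq, sum_mul_sub_sq, hmean]
  nlinarith [mul_le_mul_of_nonneg_left hr1 (sq_nonneg (∑ j : Fin H, γ ^ (j : ℕ) * r j * S j))]
end

section
/- Let T and Y be finite types, let p : T → ℝ be nonnegative with ∑_{τ ∈ T} p(τ) = 1, let q : Y → ℝ be nonnegative with ∑_{y ∈ Y} q(y) ≤ 1, let H be a natural number, let γ be a real number, for each τ ∈ T let x τ : Fin H → Y be injective, and let S : T → Fin H → ℝ. Define A : T → ℝ by A(τ) = ∑_{j ∈ Fin H} γ^j · q(x τ j) · S τ j, and B : T × Y → ℝ by B(τ, y) = ∑_{j ∈ Fin H} γ^j · [x τ j = y] · S τ j (with [·] the indicator). Then the variance of A under p is at most the variance of B under the product distribution p ⊗ q extended by assigning the leftover mass 1 - ∑_y q(y) to an outcome where B = 0; concretely: ∑_{τ} p(τ)·A(τ)^2 - (∑_{τ} p(τ)·A(τ))^2 ≤ ∑_{τ}∑_{y} p(τ)·q(y)·B(τ,y)^2 - (∑_{τ}∑_{y} p(τ)·q(y)·B(τ,y))^2. -/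
/-- Jensen's inequality for the square under a nonnegative weight of total mass at most one. -/
theorem sq_sum_mul_le_sum_mul_sq {ι : Type*} (s : Finset ι) (w f : ι → ℝ)
    (hw : ∀ i ∈ s, 0 ≤ w i) (hw1 : ∑ i ∈ s, w i ≤ 1) :
    (∑ i ∈ s, w i * f i) ^ 2 ≤ ∑ i ∈ s, w i * f i ^ 2 := by
  have hf : ∀ i ∈ s, 0 ≤ w i * f i ^ 2 := fun i hi => mul_nonneg (hw i hi) (sq_nonneg _)
  calc (∑ i ∈ s, w i * f i) ^ 2 ≤ (∑ i ∈ s, w i) * ∑ i ∈ s, w i * f i ^ 2 :=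
        Finset.sum_sq_le_sum_mul_sum_of_sq_le_mul s hw hf
          fun i _ => le_of_eq (by ring)
    _ ≤ ∑ i ∈ s, w i * f i ^ 2 := mul_le_of_le_one_left (Finset.sum_nonneg hf) hw1

theorem stmt_8 {T Y : Type*} [Fintype T] [Fintype Y] [DecidableEq Y] {H : ℕ}
    (p : T → ℝ) (hp : ∀ τ, 0 ≤ p τ) (hp1 : ∑ τ : T, p τ = 1)
    (q : Y → ℝ) (hq : ∀ y, 0 ≤ q y) (hq1 : ∑ y : Y, q y ≤ 1)
    (γ : ℝ) (x : T → Fin H → Y) (hx : ∀ τ, Function.Injective (x τ))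
    (S : T → Fin H → ℝ)
    (A : T → ℝ) (hA : ∀ τ, A τ = ∑ j : Fin H, γ ^ (j : ℕ) * q (x τ j) * S τ j)
    (B : T × Y → ℝ)
    (hB : ∀ τ y, B (τ, y) =
      ∑ j : Fin H, γ ^ (j : ℕ) * (if x τ j = y then (1 : ℝ) else 0) * S τ j) :
    ∑ τ : T, p τ * A τ ^ 2 - (∑ τ : T, p τ * A τ) ^ 2 ≤
      ∑ τ : T, ∑ y : Y, p τ * q y * B (τ, y) ^ 2 -
        (∑ τ : T, ∑ y : Y, p τ * q y * B (τ, y)) ^ 2 := by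
  have hAB : ∀ τ, A τ = ∑ y : Y, q y * B (τ, y) := by
    intro τ
    simp only [hA, hB, Finset.mul_sum]
    rw [Finset.sum_comm]
    refine Finset.sum_congr rfl fun j _ => ?_
    rw [Finset.sum_eq_single (x τ j) (fun y _ hy => by simp [hy.symm]) (by simp), if_pos rfl]
    ring
  have hmean : ∑ τ : T, ∑ y : Y, p τ * q y * B (τ, y) = ∑ τ : T, p τ * A τ := by
    simp only [hAB, Finset.mul_sum, mul_assoc]
  rw [hmean]
  gcongr with τ
  simp only [mul_assoc, ← Finset.mul_sum]
  rw [hAB]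
  exact mul_le_mul_of_nonneg_left
    (sq_sum_mul_le_sum_mul_sq _ _ _ (fun y _ => hq y) hq1) (hp τ)
end

section
/- Let T and Y be finite types, let p : T → ℝ be nonnegative with ∑_{τ ∈ T} p(τ) = 1, let q : Y → ℝ be nonnegative with ∑_{y ∈ Y} q(y) ≤ 1, let H and l be natural numbers, let γ be a real number, for each τ ∈ T let x τ : Fin H → Y be injective, and let S : T → Fin H → EuclideanSpace ℝ (Fin l). Define A : T → EuclideanSpace ℝ (Fin l) by A(τ) = ∑_{j ∈ Fin H} γ^j · q(x τ j) · S τ j, and B : T × Y → EuclideanSpace ℝ (Fin l) by B(τ, y) = ∑_{j ∈ Fin H} γ^j · [x τ j = y] · S τ j. Then ∑_{τ} p(τ)·‖A(τ)‖^2 - ‖∑_{τ} p(τ)·A(τ)‖^2 ≤ ∑_{τ}∑_{y} p(τ)·q(y)·‖B(τ,y)‖^2 - ‖∑_{τ}∑_{y} p(τ)·q(y)·B(τ,y)‖^2. -/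
/-- Jensen's inequality for the squared norm with sub-normalized weights. -/
lemma norm_sum_smul_sq_le {ι E : Type*} [SeminormedAddCommGroup E] [NormedSpace ℝ E]
    (s : Finset ι) (w : ι → ℝ) (hw : ∀ i ∈ s, 0 ≤ w i) (hw1 : ∑ i ∈ s, w i ≤ 1) (v : ι → E) :
    ‖∑ i ∈ s, w i • v i‖ ^ 2 ≤ ∑ i ∈ s, w i * ‖v i‖ ^ 2 := by
  have hnn : ∀ i ∈ s, 0 ≤ w i * ‖v i‖ ^ 2 := fun i hi => mul_nonneg (hw i hi) (sq_nonneg _)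
  calc ‖∑ i ∈ s, w i • v i‖ ^ 2
      ≤ (∑ i ∈ s, w i * ‖v i‖) ^ 2 := by
        gcongr
        refine norm_sum_le_of_le s fun i hi => ?_
        rw [norm_smul, Real.norm_of_nonneg (hw i hi)]
    _ ≤ (∑ i ∈ s, w i) * ∑ i ∈ s, w i * ‖v i‖ ^ 2 :=
        Finset.sum_sq_le_sum_mul_sum_of_sq_le_mul s hw hnn fun i _ => le_of_eq (by ring)
    _ ≤ ∑ i ∈ s, w i * ‖v i‖ ^ 2 := mul_le_of_le_one_left (Finset.sum_nonneg hnn) hw1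

theorem stmt_9 {T Y : Type*} [Fintype T] [Fintype Y] [DecidableEq Y] {H l : ℕ}
    (p : T → ℝ) (hp : ∀ τ, 0 ≤ p τ) (hp1 : ∑ τ : T, p τ = 1)
    (q : Y → ℝ) (hq : ∀ y, 0 ≤ q y) (hq1 : ∑ y : Y, q y ≤ 1)
    (γ : ℝ) (x : T → Fin H → Y) (hx : ∀ τ, Function.Injective (x τ))
    (S : T → Fin H → EuclideanSpace ℝ (Fin l))
    (A : T → EuclideanSpace ℝ (Fin l))
    (hA : ∀ τ, A τ = ∑ j : Fin H, (γ ^ (j : ℕ) * q (x τ j)) • S τ j)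
    (B : T × Y → EuclideanSpace ℝ (Fin l))
    (hB : ∀ τ y, B (τ, y) =
      ∑ j : Fin H, (γ ^ (j : ℕ) * (if x τ j = y then (1 : ℝ) else 0)) • S τ j) :
    ∑ τ : T, p τ * ‖A τ‖ ^ 2 - ‖∑ τ : T, p τ • A τ‖ ^ 2 ≤
      ∑ τ : T, ∑ y : Y, p τ * q y * ‖B (τ, y)‖ ^ 2 -
        ‖∑ τ : T, ∑ y : Y, (p τ * q y) • B (τ, y)‖ ^ 2 := by
  have hAB : ∀ τ, A τ = ∑ y : Y, q y • B (τ, y) := by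
    intro τ
    simp_rw [hA, hB, Finset.smul_sum]
    rw [Finset.sum_comm]
    refine Finset.sum_congr rfl fun j _ => ?_
    simp_rw [smul_smul, ← Finset.sum_smul]
    simp [mul_comm]
  have hmean : ∑ τ : T, p τ • A τ = ∑ τ : T, ∑ y : Y, (p τ * q y) • B (τ, y) := by
    simp_rw [hAB, Finset.smul_sum, smul_smul]
  rw [hmean]
  gcongr with τ
  simp_rw [mul_assoc, ← Finset.mul_sum]
  rw [hAB]
  exact mul_le_mul_of_nonneg_left
    (norm_sum_smul_sq_le _ q (fun y _ => hq y) hq1 fun y => B (τ, y)) (hp τ)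
end
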